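/- There is no operation f : {0,1,2}^4 → {0,1,2} that preserves both C_3 and R^=_3 and satisfies the guarded 3-cyclic identities f(x_1,x_2,x_3,y) = f(x_2,x_3,x_1,y) and f(x,x,x,y) = f(x,x,x,x) for all x_1,x_2,x_3,x,y ∈ {0,1,2}. -/

import Mathlib

/-- The three-element domain `{0,1,2}`. -/
abbrev D3 : Type := Fin 3

/-- `n`-ary operations on `{0,1,2}`. -/
abbrev Op (n : ℕ) : Type := (Fin n → D3) → D3

/-- An `n`-ary operation `f` preserves a `k`-ary relation `R`. -/
def Preserves {n k : ℕ} (f : Op n) (R : Set (Fin k → D3)) : Prop :=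
  ∀ t : Fin n → (Fin k → D3), (∀ i, t i ∈ R) → (fun j => f fun i => t i j) ∈ R

/-- `C₃ = {(0,1),(1,2),(2,0)}`. -/
def C3rel : Set (Fin 2 → D3) :=
  { t | (t 0 = 0 ∧ t 1 = 1) ∨ (t 0 = 1 ∧ t 1 = 2) ∨ (t 0 = 2 ∧ t 1 = 0) }

/-- `R⁼₃ = {(x,y,z) : x ∈ {0,1} ∧ (x = 0 → y = z)}`. -/
def Req3rel : Set (Fin 3 → D3) :=
  { t | (t 0 = 0 ∨ t 0 = 1) ∧ (t 0 = 0 → t 1 = t 2) }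

/-- No operation `f : {0,1,2}⁴ → {0,1,2}` preserving both `C₃` and `R⁼₃` satisfies the
guarded 3-cyclic identities. -/
theorem stmt15 :
    ¬ ∃ f : Op 4, Preserves f C3rel ∧ Preserves f Req3rel ∧
      (∀ x1 x2 x3 y : D3, f ![x1, x2, x3, y] = f ![x2, x3, x1, y]) ∧
      (∀ x y : D3, f ![x, x, x, y] = f ![x, x, x, x]) := by
  rintro ⟨f, hC, hR, hcyc, hg⟩
  have e : ∀ (k : ℕ) (a b c d : Fin k → D3) (j : Fin k),
      (fun i => (![a, b, c, d] : Fin 4 → Fin k → D3) i j) = ![a j, b j, c j, d j] := by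
    intro k a b c d j
    funext i
    fin_cases i <;> rfl
  have h1 := hC ![![0, 1], ![0, 1], ![0, 1], ![0, 1]] (by
    intro i; fin_cases i <;> simp [C3rel])
  have h2 := hC ![![0, 1], ![1, 2], ![2, 0], ![0, 1]] (by
    intro i; fin_cases i <;> simp [C3rel])
  have h3 := hR ![![1, 0, 0], ![1, 0, 0], ![1, 0, 0], ![1, 0, 0]] (by
    intro i; fin_cases i <;> simp [Req3rel])
  have h4 := hR ![![0, 0, 0], ![0, 1, 1], ![0, 2, 2], ![1, 0, 1]] (by
    intro i; fin_cases i <;> simp [Req3rel])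
  have h5 := hR ![![0, 0, 0], ![0, 0, 0], ![0, 0, 0], ![0, 0, 0]] (by
    intro i; fin_cases i <;> simp [Req3rel])
  have g := hg 0 1
  have c := hcyc 0 1 2 1
  simp only [C3rel, Req3rel, Set.mem_setOf_eq, e] at h1 h2 h3 h4 h5
  simp only [Matrix.cons_val_zero, Matrix.cons_val_one, Matrix.cons_val] at h1 h2 h3 h4 h5
  generalize f ![0, 0, 0, 0] = a at *
  generalize f ![1, 1, 1, 1] = b at *
  generalize f ![0, 0, 0, 1] = p at *
  generalize f ![0, 1, 2, 0] = q at *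
  generalize f ![0, 1, 2, 1] = r at *
  generalize f ![1, 2, 0, 1] = s at *
  clear hC hR hcyc hg e
  grind
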